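/- arXiv:1303.2587 — 6 statements merged into one kernel-verified Lean document; each statement's English description precedes it below -/
import Mathlib

section
/- Let ρ0 > 0, ρmax > 0, J ≥ 0 and M ≥ 1 integers with (J+1)M ≥ 2. For each integer K ≥ 2 let w_K^{UB} be the unique positive solution of w/ρ0 + ((J+1)M − 1)·ln(1 + (ρmax/ρ0)·w) = ln K. Then there exist C > 0 and K₀ such that for all K ≥ K₀, |w_K^{UB} − (ρ0·ln K − ρ0·((J+1)M − 1)·ln(ρmax·ln K))| ≤ C·ln ln ln K; in particular w_K^{UB} = ρ0 ln K − ρ0((J+1)M−1)·ln(ρmax ln K) + O(ln ln ln K) as K → ∞. -/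
open Real

/-- Asymptotics of the upper normalizing sequence: if `w_K^{UB}` is the unique
positive solution of `w/ρ0 + ((J+1)M − 1)·ln(1 + (ρmax/ρ0)·w) = ln K`, then
`w_K^{UB} = ρ0 ln K − ρ0((J+1)M−1)·ln(ρmax ln K) + O(ln ln ln K)` as `K → ∞`. -/
theorem normalizing_sequence_UB_asymptotics
    {ρ0 ρmax : ℝ} (hρ0 : 0 < ρ0) (hρmax : 0 < ρmax)
    {J M : ℕ} (hM : 1 ≤ M) (hJM : 2 ≤ (J + 1) * M)
    (w : ℕ → ℝ)
    (hw : ∀ K : ℕ, 2 ≤ K → 0 < w K ∧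
      w K / ρ0 + (((J + 1) * M : ℝ) - 1) * Real.log (1 + (ρmax / ρ0) * w K) = Real.log K) :
    ∃ C : ℝ, 0 < C ∧ ∃ K₀ : ℕ, ∀ K : ℕ, K₀ ≤ K →
      |w K - (ρ0 * Real.log K
          - ρ0 * (((J + 1) * M : ℝ) - 1) * Real.log (ρmax * Real.log K))|
        ≤ C * Real.log (Real.log (Real.log K)) := by
  have hn : (1:ℝ) ≤ ((J + 1) * M : ℝ) - 1 := by
    have : (2:ℝ) ≤ (J + 1) * M := by exact_mod_cast hJM
    linarith
  generalize ((J + 1) * M : ℝ) - 1 = n at hn hw ⊢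
  have hn0 : 0 < n := by linarith
  have hlog2 : 0 < Real.log 2 := Real.log_pos (by norm_num)
  have tL : Filter.Tendsto (fun K : ℕ => Real.log (K : ℝ)) Filter.atTop Filter.atTop :=
    Real.tendsto_log_atTop.comp tendsto_natCast_atTop_atTop
  have tLLL : Filter.Tendsto (fun K : ℕ => Real.log (Real.log (Real.log (K : ℝ))))
      Filter.atTop Filter.atTop :=
    Real.tendsto_log_atTop.comp (Real.tendsto_log_atTop.comp tL)
  have tR : Filter.Tendsto (fun K : ℕ => ρmax * Real.log (K : ℝ)) Filter.atTop Filter.atTop :=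
    tL.const_mul_atTop hρmax
  have tY : Filter.Tendsto (fun K : ℕ => 1 + ρmax * Real.log (K : ℝ)) Filter.atTop Filter.atTop :=
    Filter.tendsto_atTop_add_const_left _ 1 tR
  have hc : 0 < 1 / (4 * n * ρmax) := by positivity
  have e1 := tY.eventually (Real.isLittleO_log_id_atTop.bound hc)
  have e2 := tR.eventually_ge_atTop 1
  have e3 := tLLL.eventually_ge_atTop 1
  have e4 := Filter.eventually_ge_atTop (α := ℕ) 2
  obtain ⟨K₀, hK₀⟩ := Filter.eventually_atTop.1 (e1.and (e2.and (e3.and e4)))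
  refine ⟨ρ0 * n * Real.log 2, by positivity, K₀, fun K hK => ?_⟩
  obtain ⟨h1, h2, h3, h4⟩ := hK₀ K hK
  obtain ⟨hwp, hweq⟩ := hw K h4
  generalize w K = x at hwp hweq ⊢
  generalize Real.log (Real.log (Real.log (K : ℝ))) = T at h3 ⊢
  generalize Real.log (K : ℝ) = L at h1 h2 hweq ⊢
  have hax : 0 < ρmax / ρ0 * x := by positivity
  have hyx : 0 < Real.log (1 + ρmax / ρ0 * x) := Real.log_pos (by linarith)
  have hxeq : x = ρ0 * L - ρ0 * n * Real.log (1 + ρmax / ρ0 * x) := by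
    rw [← hweq]; field_simp; ring
  have hup : ρmax / ρ0 * x ≤ ρmax * L := by
    have : x ≤ ρ0 * L := by
      have : 0 < ρ0 * n * Real.log (1 + ρmax / ρ0 * x) := by positivity
      linarith
    calc ρmax / ρ0 * x ≤ ρmax / ρ0 * (ρ0 * L) := by gcongr
      _ = ρmax * L := by field_simp
  have hlu : Real.log (1 + ρmax / ρ0 * x) ≤ Real.log (1 + ρmax * L) :=
    Real.log_le_log (by linarith) (by linarith)
  have h1' : n * Real.log (1 + ρmax * L) ≤ L / 2 := by
    have ha : Real.log (1 + ρmax * L) ≤ 1 / (4 * n * ρmax) * (2 * (ρmax * L)) := by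
      refine (le_abs_self _).trans (h1.trans ?_)
      simp only [id, Real.norm_eq_abs]
      rw [abs_of_pos (by linarith)]
      gcongr
      linarith
    calc n * Real.log (1 + ρmax * L) ≤ n * (1 / (4 * n * ρmax) * (2 * (ρmax * L))) := by gcongr
      _ = L / 2 := by field_simp; norm_num
  have hlow : ρmax * L / 2 ≤ ρmax / ρ0 * x := by
    have hb : n * Real.log (1 + ρmax / ρ0 * x) ≤ L / 2 :=
      (mul_le_mul_of_nonneg_left hlu hn0.le).trans h1'
    have hb' : ρ0 * (L / 2) ≤ x := by
      have := mul_le_mul_of_nonneg_left hb hρ0.le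
      linarith
    calc ρmax * L / 2 = ρmax / ρ0 * (ρ0 * (L / 2)) := by field_simp
      _ ≤ _ := by gcongr
  have hRL : 0 < ρmax * L := by linarith
  have g1 : Real.log (1 + ρmax / ρ0 * x) ≤ Real.log 2 + Real.log (ρmax * L) := by
    rw [← Real.log_mul (by norm_num) hRL.ne']
    exact Real.log_le_log (by linarith) (by linarith)
  have g2 : Real.log (ρmax * L) ≤ Real.log 2 + Real.log (1 + ρmax / ρ0 * x) := by
    rw [← Real.log_mul (by norm_num) (by linarith)]
    exact Real.log_le_log hRL (by linarith)
  have hd : x - (ρ0 * L - ρ0 * n * Real.log (ρmax * L))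
      = ρ0 * n * (Real.log (ρmax * L) - Real.log (1 + ρmax / ρ0 * x)) := by
    linarith
  have hpn : 0 < ρ0 * n := by positivity
  rw [hd, abs_mul, abs_of_pos hpn]
  have hab : |Real.log (ρmax * L) - Real.log (1 + ρmax / ρ0 * x)| ≤ Real.log 2 :=
    abs_le.2 ⟨by linarith, by linarith⟩
  calc _ ≤ ρ0 * n * Real.log 2 := by gcongr
    _ ≤ _ := le_mul_of_one_le_right (by positivity) h3
end

section
/- Let ρ0 > 0, ρmin > 0, J ≥ 0 and M ≥ 1 integers with (J+1)M ≥ 2. For each integer K ≥ 2 let w_K^{LB} be the unique positive solution of w/ρ0 + ((J+1)M − 1)·ln(1 + (ρmin/ρ0)·w) = ln K. Then there exist C > 0 and K₀ such that for all K ≥ K₀, |w_K^{LB} − (ρ0·ln K − ρ0·((J+1)M − 1)·ln(ρmin·ln K))| ≤ C·ln ln ln K; in particular w_K^{LB} = ρ0 ln K − ρ0((J+1)M−1)·ln(ρmin ln K) + O(ln ln ln K) as K → ∞. -/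
open Real

/-- Asymptotics of the lower normalizing sequence: if `w_K^{LB}` is the unique
positive solution of `w/ρ0 + ((J+1)M − 1)·ln(1 + (ρmin/ρ0)·w) = ln K`, then
`w_K^{LB} = ρ0 ln K − ρ0((J+1)M−1)·ln(ρmin ln K) + O(ln ln ln K)` as `K → ∞`. -/
theorem normalizing_sequence_LB_asymptotics
    {ρ0 ρmin : ℝ} (hρ0 : 0 < ρ0) (hρmin : 0 < ρmin)
    {J M : ℕ} (hM : 1 ≤ M) (hJM : 2 ≤ (J + 1) * M)
    (w : ℕ → ℝ)
    (hw : ∀ K : ℕ, 2 ≤ K → 0 < w K ∧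
      w K / ρ0 + (((J + 1) * M : ℝ) - 1) * Real.log (1 + (ρmin / ρ0) * w K) = Real.log K) :
    ∃ C : ℝ, 0 < C ∧ ∃ K₀ : ℕ, ∀ K : ℕ, K₀ ≤ K →
      |w K - (ρ0 * Real.log K
          - ρ0 * (((J + 1) * M : ℝ) - 1) * Real.log (ρmin * Real.log K))|
        ≤ C * Real.log (Real.log (Real.log K)) := by
  obtain ⟨n, hn⟩ : ∃ n : ℝ, n = (((J + 1) * M : ℝ) - 1) := ⟨_, rfl⟩
  have hn1 : 1 ≤ n := by
    have h : (2 : ℝ) ≤ (J + 1) * M := by exact_mod_cast hJM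
    linarith
  simp only [← hn] at hw ⊢
  have hD : 1 ≤ 1 + n * ρmin := by
    have : 0 < n * ρmin := by positivity
    linarith
  have hlogD : 0 ≤ Real.log (1 + n * ρmin) := Real.log_nonneg hD
  have hlog2 : 0 < Real.log 2 := Real.log_pos (by norm_num)
  have hL : Filter.Tendsto (fun K : ℕ => Real.log (K : ℝ)) Filter.atTop Filter.atTop :=
    Real.tendsto_log_atTop.comp tendsto_natCast_atTop_atTop
  have hLLL : Filter.Tendsto (fun K : ℕ => Real.log (Real.log (Real.log (K : ℝ))))
      Filter.atTop Filter.atTop :=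
    Real.tendsto_log_atTop.comp (Real.tendsto_log_atTop.comp hL)
  obtain ⟨K₀, hK₀⟩ := Filter.eventually_atTop.mp
    ((hLLL.eventually_ge_atTop 1).and
      ((hL.eventually_ge_atTop (1 / ρmin)).and (Filter.eventually_ge_atTop 2)))
  refine ⟨ρ0 * n * (Real.log 2 + Real.log (1 + n * ρmin)), by positivity, K₀, ?_⟩
  intro K hK
  obtain ⟨h1, h2, h3⟩ := hK₀ K hK
  obtain ⟨hwpos, heq⟩ := hw K h3
  generalize w K = v at *
  generalize Real.log (K : ℝ) = L at *
  have hX : 1 ≤ ρmin * L := by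
    rw [div_le_iff₀ hρmin] at h2
    linarith
  have ha : 0 < ρmin / ρ0 * v := by positivity
  have hlogy : 0 ≤ Real.log (1 + ρmin / ρ0 * v) := Real.log_nonneg (by linarith)
  have hlogy2 : Real.log (1 + ρmin / ρ0 * v) ≤ ρmin / ρ0 * v := by
    have := Real.log_le_sub_one_of_pos (show 0 < 1 + ρmin / ρ0 * v by linarith)
    linarith
  have hav : ρmin / ρ0 * v = ρmin * (v / ρ0) := by ring
  have hup : ρmin / ρ0 * v ≤ ρmin * L := by
    rw [hav]
    apply mul_le_mul_of_nonneg_left _ hρmin.le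
    have : 0 ≤ n * Real.log (1 + ρmin / ρ0 * v) := by positivity
    linarith
  have hlow : ρmin * L ≤ (1 + n * ρmin) * (ρmin / ρ0 * v) := by
    have h5 : L ≤ v / ρ0 + n * (ρmin / ρ0 * v) := by
      rw [← heq]
      gcongr
    calc ρmin * L ≤ ρmin * (v / ρ0 + n * (ρmin / ρ0 * v)) := by gcongr
      _ = _ := by ring
  have e1 : Real.log (1 + ρmin / ρ0 * v) ≤ Real.log 2 + Real.log (ρmin * L) := by
    rw [← Real.log_mul (by norm_num) (by linarith)]
    exact Real.log_le_log (by linarith) (by linarith)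
  have e2 : Real.log (ρmin * L) ≤ Real.log (1 + n * ρmin) + Real.log (1 + ρmin / ρ0 * v) := by
    rw [← Real.log_mul (by linarith) (by linarith)]
    exact Real.log_le_log (by linarith) (by nlinarith)
  have hv : v = ρ0 * L - ρ0 * n * Real.log (1 + ρmin / ρ0 * v) := by
    have : v = ρ0 * (v / ρ0) := by field_simp
    rw [← heq]
    linear_combination this
  have key : v - (ρ0 * L - ρ0 * n * Real.log (ρmin * L))
      = ρ0 * n * (Real.log (ρmin * L) - Real.log (1 + ρmin / ρ0 * v)) := by
    linear_combination hv
  have hpos : 0 < ρ0 * n := by positivity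
  rw [key, abs_mul, abs_of_pos hpos]
  have habs : |Real.log (ρmin * L) - Real.log (1 + ρmin / ρ0 * v)|
      ≤ Real.log 2 + Real.log (1 + n * ρmin) := by
    rw [abs_le]
    constructor <;> linarith
  calc _ ≤ ρ0 * n * (Real.log 2 + Real.log (1 + n * ρmin)) := by gcongr
    _ ≤ _ := le_mul_of_one_le_right (by positivity) h1
end

section
/- Let ρ0 > 0, ρ1, …, ρJ > 0, M ≥ 1 an integer with (J+1)M ≥ 2, and define F(x) = 1 − e^{−x/ρ0} / ((1+x)^{M−1} · ∏_{b=1}^{J} (1 + (ρb/ρ0)·x)^{M}). For each integer K ≥ 2 let w_K be the unique nonnegative solution of 1 − F(w_K) = 1/K. Then there exist C > 0 and K₀ such that for all K ≥ K₀, |w_K − (ρ0·ln K − ρ0·((J+1)M − 1)·ln ln K)| ≤ C·ln ln ln K. -/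
open Real

lemma aux_up {r a L w : ℝ} (hr : 0 < r) (ha : 0 < a) (hL : 1 ≤ L) (hw0 : 0 ≤ w) (hw : w ≤ r * L) :
    Real.log (1 + a * w) ≤ Real.log L + Real.log (1 + a * r) := by
  have h1 : 0 < 1 + a * r := by positivity
  rw [← Real.log_mul (by linarith) h1.ne']
  apply Real.log_le_log (by positivity)
  nlinarith [mul_le_mul_of_nonneg_left hw ha.le]

lemma aux_lo {r a L w : ℝ} (hr : 0 < r) (ha : 0 < a) (hL : 1 ≤ L) (hw : r * L / 2 ≤ w) :
    Real.log L + Real.log (a * r / 2) ≤ Real.log (1 + a * w) := by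
  have h1 : 0 < a * r / 2 := by positivity
  have h2 : 0 < L := by linarith
  rw [← Real.log_mul (by linarith) h1.ne']
  apply Real.log_le_log (by positivity)
  nlinarith [mul_le_mul_of_nonneg_left hw ha.le]

/-- Asymptotics of the normalizing sequence `w_K` defined by
`1 − F(w_K) = 1/K` for the SINR CDF `F`:
`w_K = ρ0·ln K − ρ0·((J+1)M − 1)·ln ln K + O(ln ln ln K)` as `K → ∞`. -/
theorem sinr_normalizing_sequence_asymptotics
    {M J : ℕ} (hM : 1 ≤ M) (hJM : 2 ≤ (J + 1) * M)
    {ρ0 : ℝ} (hρ0 : 0 < ρ0) {ρ : Fin J → ℝ} (hρ : ∀ b, 0 < ρ b)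
    (F : ℝ → ℝ)
    (hF : ∀ x : ℝ, F x = 1 - Real.exp (-x / ρ0) /
      ((1 + x) ^ (M - 1) * ∏ b : Fin J, (1 + (ρ b / ρ0) * x) ^ M))
    (w : ℕ → ℝ)
    (hw : ∀ K : ℕ, 2 ≤ K → 0 ≤ w K ∧ 1 - F (w K) = 1 / (K : ℝ)) :
    ∃ C : ℝ, 0 < C ∧ ∃ K₀ : ℕ, ∀ K : ℕ, K₀ ≤ K →
      |w K - (ρ0 * Real.log K
          - ρ0 * (((J + 1) * M : ℝ) - 1) * Real.log (Real.log K))|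
        ≤ C * Real.log (Real.log (Real.log K)) := by
  have ha : ∀ b, 0 < ρ b / ρ0 := fun b => div_pos (hρ b) hρ0
  set N : ℝ := ((J + 1) * M : ℝ) - 1 with hN
  set S : ℝ → ℝ := fun x => ((M - 1 : ℕ) : ℝ) * Real.log (1 + 1 * x)
    + ∑ b : Fin J, (M : ℝ) * Real.log (1 + (ρ b / ρ0) * x) with hS
  set D1 : ℝ := ((M - 1 : ℕ) : ℝ) * Real.log (1 + 1 * ρ0)
    + ∑ b : Fin J, (M : ℝ) * Real.log (1 + (ρ b / ρ0) * ρ0) with hD1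
  set D2 : ℝ := ((M - 1 : ℕ) : ℝ) * Real.log (1 * ρ0 / 2)
    + ∑ b : Fin J, (M : ℝ) * Real.log ((ρ b / ρ0) * ρ0 / 2) with hD2
  have hNL : ∀ l : ℝ, N * l = ((M - 1 : ℕ) : ℝ) * l + ∑ b : Fin J, (M : ℝ) * l := by
    intro l
    rw [Nat.cast_sub hM]
    simp [hN]
    ring
  have hup : ∀ L x : ℝ, 1 ≤ L → 0 ≤ x → x ≤ ρ0 * L → S x ≤ N * Real.log L + D1 := by
    intro L x hL hx0 hx
    have e : N * Real.log L + D1 = ((M - 1 : ℕ) : ℝ) * (Real.log L + Real.log (1 + 1 * ρ0))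
        + ∑ b : Fin J, (M : ℝ) * (Real.log L + Real.log (1 + (ρ b / ρ0) * ρ0)) := by
      rw [hNL, hD1]; simp only [mul_add, Finset.sum_add_distrib]; ring
    rw [e]
    refine add_le_add ?_ (Finset.sum_le_sum fun b _ => ?_)
    · exact mul_le_mul_of_nonneg_left (aux_up hρ0 one_pos hL hx0 hx) (Nat.cast_nonneg _)
    · exact mul_le_mul_of_nonneg_left (aux_up hρ0 (ha b) hL hx0 hx) (Nat.cast_nonneg _)
  have hlo : ∀ L x : ℝ, 1 ≤ L → ρ0 * L / 2 ≤ x → N * Real.log L + D2 ≤ S x := by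
    intro L x hL hx
    have e : N * Real.log L + D2 = ((M - 1 : ℕ) : ℝ) * (Real.log L + Real.log (1 * ρ0 / 2))
        + ∑ b : Fin J, (M : ℝ) * (Real.log L + Real.log ((ρ b / ρ0) * ρ0 / 2)) := by
      rw [hNL, hD2]; simp only [mul_add, Finset.sum_add_distrib]; ring
    rw [e]
    refine add_le_add ?_ (Finset.sum_le_sum fun b _ => ?_)
    · exact mul_le_mul_of_nonneg_left (aux_lo hρ0 one_pos hL hx) (Nat.cast_nonneg _)
    · exact mul_le_mul_of_nonneg_left (aux_lo hρ0 (ha b) hL hx) (Nat.cast_nonneg _)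
  have hS0 : ∀ x, 0 ≤ x → 0 ≤ S x := by
    intro x hx
    refine add_nonneg (mul_nonneg (Nat.cast_nonneg _) (Real.log_nonneg (by linarith)))
      (Finset.sum_nonneg fun b _ => mul_nonneg (Nat.cast_nonneg _) (Real.log_nonneg ?_))
    have := mul_nonneg (ha b).le hx
    linarith
  have heq : ∀ K : ℕ, 2 ≤ K → w K = ρ0 * (Real.log K - S (w K)) := by
    intro K hK
    obtain ⟨h0, h1⟩ := hw K hK
    have hp : 0 < 1 + w K := by linarith
    have hq : ∀ b, 0 < 1 + (ρ b / ρ0) * w K := fun b => by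
      have := mul_nonneg (ha b).le h0
      linarith
    have hprod : 0 < ∏ b : Fin J, (1 + (ρ b / ρ0) * w K) ^ M :=
      Finset.prod_pos fun b _ => pow_pos (hq b) _
    have hpp : 0 < (1 + w K) ^ (M - 1) := pow_pos hp _
    rw [hF] at h1
    have h2 := congrArg Real.log h1
    rw [sub_sub_cancel, Real.log_div (Real.exp_pos _).ne' (mul_pos hpp hprod).ne', Real.log_exp,
      Real.log_mul hpp.ne' hprod.ne', Real.log_pow, Real.log_prod (fun b _ => (pow_pos (hq b) _).ne'),
      one_div, Real.log_inv] at h2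
    simp only [Real.log_pow] at h2
    have h3 : Real.log K - S (w K) = w K / ρ0 := by
      simp only [hS, one_mul]
      rw [neg_div] at h2
      linarith
    rw [h3]; field_simp
  have hlogT : Filter.Tendsto (fun K : ℕ => Real.log (K : ℝ)) Filter.atTop Filter.atTop :=
    Real.tendsto_log_atTop.comp tendsto_natCast_atTop_atTop
  have hlll : ∀ᶠ K : ℕ in Filter.atTop, 1 ≤ Real.log (Real.log (Real.log K)) :=
    (Real.tendsto_log_atTop.comp (Real.tendsto_log_atTop.comp hlogT)).eventually_ge_atTop 1
  have hlin : ∀ᶠ L : ℝ in Filter.atTop, N * Real.log L + D1 ≤ L / 2 := by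
    have h1 : (fun L : ℝ => N * Real.log L + D1) =o[Filter.atTop] (fun L : ℝ => L) :=
      (Real.isLittleO_log_id_atTop.const_mul_left N).add
        (Asymptotics.isLittleO_const_id_atTop D1)
    filter_upwards [h1.bound (show (0:ℝ) < 1/2 by norm_num), Filter.eventually_ge_atTop 0] with L h hL
    rw [Real.norm_eq_abs, Real.norm_eq_abs, abs_of_nonneg hL] at h
    linarith [le_abs_self (N * Real.log L + D1)]
  have hev := (((hlll.and (hlogT.eventually hlin)).and (hlogT.eventually_ge_atTop 1)).and
    (Filter.eventually_ge_atTop 2))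
  obtain ⟨K₀, hK₀⟩ := Filter.eventually_atTop.1 hev
  refine ⟨ρ0 * (|D1| + |D2|) + 1, by positivity, K₀, fun K hK => ?_⟩
  obtain ⟨⟨⟨h3, h4⟩, h5⟩, h6⟩ := hK₀ K hK
  have hwe := heq K h6
  have hw0 := (hw K h6).1
  have hwu : w K ≤ ρ0 * Real.log K := by
    nlinarith [mul_nonneg hρ0.le (hS0 _ hw0)]
  have hu := hup _ _ h5 hw0 hwu
  have hwl : ρ0 * Real.log K / 2 ≤ w K := by
    nlinarith [mul_le_mul_of_nonneg_left (hu.trans h4) hρ0.le]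
  have hl := hlo _ _ h5 hwl
  have e : w K - (ρ0 * Real.log K - ρ0 * N * Real.log (Real.log K))
      = -(ρ0 * (S (w K) - N * Real.log (Real.log K))) := by linear_combination hwe
  rw [e, abs_neg, abs_mul, abs_of_pos hρ0]
  have hb : |S (w K) - N * Real.log (Real.log K)| ≤ |D1| + |D2| := by
    rw [abs_le]
    constructor
    · linarith [neg_abs_le D2, abs_nonneg D1]
    · linarith [le_abs_self D1, abs_nonneg D2]
  have hc := mul_le_mul_of_nonneg_left hb hρ0.le
  have hd : 0 ≤ ρ0 * (|D1| + |D2|) := by positivity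
  nlinarith
end

section
/- Let ρ0 > 0, ρ1, …, ρJ > 0, M ≥ 1 an integer, and define F(x) = 1 − e^{−x/ρ0} / ((1+x)^{M−1} · ∏_{b=1}^{J} (1 + (ρb/ρ0)·x)^{M}). For integers K ≥ 2 set t_K = ρ0·ln K − ρ0·(J+1)·M·ln ln K. Then there exist C > 0 and K₀ such that for all K ≥ K₀, (F(max(t_K, 0)))^K ≤ C/ln K. (Equivalently, the maximum of K i.i.d. random variables with CDF F exceeds t_K with probability at least 1 − C/ln K.) -/
open Real

/-- With `t_K = ρ0·ln K − ρ0·(J+1)·M·ln ln K`, the maximum of `K` i.i.d.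
SINRs exceeds `t_K` with probability at least `1 − C/ln K`:
`(F(max(t_K, 0)))^K ≤ C/ln K` for all large `K`. -/
theorem sinr_max_lower_concentration
    {M J : ℕ} (hM : 1 ≤ M) {ρ0 : ℝ} (hρ0 : 0 < ρ0) {ρ : Fin J → ℝ} (hρ : ∀ b, 0 < ρ b)
    (F : ℝ → ℝ)
    (hF : ∀ x : ℝ, F x = 1 - Real.exp (-x / ρ0) /
      ((1 + x) ^ (M - 1) * ∏ b : Fin J, (1 + (ρ b / ρ0) * x) ^ M))
    (t : ℕ → ℝ)
    (ht : ∀ K : ℕ, t K = ρ0 * Real.log K - ρ0 * ((J : ℝ) + 1) * (M : ℝ) * Real.log (Real.log K)) :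
    ∃ C : ℝ, 0 < C ∧ ∃ K₀ : ℕ, ∀ K : ℕ, K₀ ≤ K →
      (F (max (t K) 0)) ^ K ≤ C / Real.log K := by
  have hc : 0 < (1 + ρ0) ^ (M - 1) * ∏ b : Fin J, (1 + ρ b) ^ M := by
    refine mul_pos (by positivity) (Finset.prod_pos fun b _ => ?_)
    have := hρ b
    positivity
  set c := (1 + ρ0) ^ (M - 1) * ∏ b : Fin J, (1 + ρ b) ^ M with hcdef
  refine ⟨c, hc, 3, fun K hK => ?_⟩
  have hK3 : (3 : ℝ) ≤ K := by exact_mod_cast hK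
  have hK0 : (0 : ℝ) < K := by linarith
  have hL1 : 1 ≤ Real.log K := by
    rw [Real.le_log_iff_exp_le hK0]
    linarith [Real.exp_one_lt_three]
  have htK := ht K
  set L := Real.log K with hL
  have hL0 : 0 < L := by linarith
  have hLL : 0 ≤ Real.log L := Real.log_nonneg hL1
  rcases lt_or_ge (t K) 0 with hneg | hpos
  · rw [max_eq_right hneg.le, hF]
    have : K ≠ 0 := by omega
    simp [this]
    positivity
  rw [max_eq_left hpos]
  have hxle : t K ≤ ρ0 * L := by
    rw [htK]
    have : 0 ≤ ρ0 * ((J : ℝ) + 1) * (M : ℝ) * Real.log L := by positivity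
    linarith
  set x := t K with hx
  have hD1 : 1 ≤ (1 + x) ^ (M - 1) * ∏ b : Fin J, (1 + (ρ b / ρ0) * x) ^ M := by
    refine one_le_mul_of_one_le_of_one_le (one_le_pow₀ (by linarith)) ?_
    have hp : ∏ _b : Fin J, (1 : ℝ) ≤ ∏ b : Fin J, (1 + (ρ b / ρ0) * x) ^ M := by
      refine Finset.prod_le_prod (fun _ _ => zero_le_one) fun b _ => one_le_pow₀ ?_
      have := hρ b
      have : 0 ≤ ρ b / ρ0 * x := by positivity
      linarith
    simpa using hp
  have hD2 : (1 + x) ^ (M - 1) * ∏ b : Fin J, (1 + (ρ b / ρ0) * x) ^ M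
      ≤ c * L ^ ((M - 1) + J * M) := by
    have h1 : (1 + x) ^ (M - 1) ≤ ((1 + ρ0) * L) ^ (M - 1) := by
      gcongr
      nlinarith
    have h2 : ∏ b : Fin J, (1 + (ρ b / ρ0) * x) ^ M ≤ ∏ b : Fin J, ((1 + ρ b) * L) ^ M := by
      refine Finset.prod_le_prod (fun b _ => ?_) (fun b _ => ?_)
      · have := hρ b
        positivity
      · have := hρ b
        have h3 : ρ b / ρ0 * x ≤ ρ b / ρ0 * (ρ0 * L) := by gcongr
        have h4 : ρ b / ρ0 * (ρ0 * L) = ρ b * L := by field_simp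
        gcongr
        linarith
    have h0 : 0 ≤ ∏ b : Fin J, (1 + (ρ b / ρ0) * x) ^ M := by
      refine Finset.prod_nonneg fun b _ => ?_
      have := hρ b
      positivity
    refine (mul_le_mul h1 h2 h0 (by positivity)).trans (le_of_eq ?_)
    simp only [mul_pow, Finset.prod_mul_distrib, Finset.prod_const, Finset.card_univ,
      Fintype.card_fin, hcdef]
    rw [pow_add, mul_comm J M, pow_mul]
    ring
  have hexp : (K : ℝ) * Real.exp (-x / ρ0) = L ^ ((J + 1) * M) := by
    have : -x / ρ0 = (((J + 1) * M : ℕ) : ℝ) * Real.log L - Real.log K := by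
      rw [htK]
      push_cast
      field_simp
      ring
    rw [this, Real.exp_sub, Real.exp_log hK0, Real.exp_nat_mul, Real.exp_log hL0]
    field_simp
  set D := (1 + x) ^ (M - 1) * ∏ b : Fin J, (1 + (ρ b / ρ0) * x) ^ M with hD
  have hD0 : 0 < D := by linarith
  have hFx : F x = 1 - Real.exp (-x / ρ0) / D := hF x
  have hp1 : Real.exp (-x / ρ0) / D ≤ 1 := by
    rw [div_le_one hD0]
    refine le_trans (Real.exp_le_one_iff.2 ?_) hD1
    exact div_nonpos_of_nonpos_of_nonneg (by linarith) hρ0.le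
  have hKp : L / c ≤ K * (Real.exp (-x / ρ0) / D) := by
    rw [← mul_div_assoc, hexp, div_le_div_iff₀ hc hD0]
    have he : (J + 1) * M = ((M - 1) + J * M) + 1 := by
      rw [add_mul]
      omega
    rw [he, pow_succ]
    nlinarith
  have hLc : 0 < L / c := by positivity
  calc F x ^ K ≤ Real.exp (-(Real.exp (-x / ρ0) / D)) ^ K := by
        rw [hFx]
        refine pow_le_pow_left₀ (by linarith) ?_ K
        exact Real.one_sub_le_exp_neg _
    _ = Real.exp (-(K * (Real.exp (-x / ρ0) / D))) := by
        rw [← Real.exp_nat_mul]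
        ring_nf
    _ ≤ Real.exp (-(L / c)) := Real.exp_le_exp.2 (by linarith)
    _ ≤ (L / c)⁻¹ := by
        rw [Real.exp_neg]
        refine inv_anti₀ hLc ?_
        linarith [Real.add_one_le_exp (L / c)]
    _ = c / L := by rw [inv_div]
end

section
/- Let ρ0 > 0, ρ1, …, ρJ > 0, M ≥ 1 an integer, and define F(x) = 1 − e^{−x/ρ0} / ((1+x)^{M−1} · ∏_{b=1}^{J} (1 + (ρb/ρ0)·x)^{M}). For integers K ≥ 2 set s_K = ρ0·ln K − ρ0·((J+1)·M − 2)·ln ln K. Then there exist C > 0 and K₀ such that for all K ≥ K₀, K·(1 − F(s_K)) ≤ C/ln K. (Equivalently, the maximum of K i.i.d. random variables with CDF F exceeds s_K with probability at most C/ln K.) -/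
open Real

/-- With `s_K = ρ0·ln K − ρ0·((J+1)·M − 2)·ln ln K`, the maximum of `K` i.i.d.
SINRs exceeds `s_K` with probability at most `C/ln K`:
`K·(1 − F(s_K)) ≤ C/ln K` for all large `K`. -/
theorem sinr_max_upper_concentration
    {M J : ℕ} (hM : 1 ≤ M) {ρ0 : ℝ} (hρ0 : 0 < ρ0) {ρ : Fin J → ℝ} (hρ : ∀ b, 0 < ρ b)
    (F : ℝ → ℝ)
    (hF : ∀ x : ℝ, F x = 1 - Real.exp (-x / ρ0) /
      ((1 + x) ^ (M - 1) * ∏ b : Fin J, (1 + (ρ b / ρ0) * x) ^ M))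
    (s : ℕ → ℝ)
    (hs : ∀ K : ℕ, s K = ρ0 * Real.log K
      - ρ0 * (((J : ℝ) + 1) * (M : ℝ) - 2) * Real.log (Real.log K)) :
    ∃ C : ℝ, 0 < C ∧ ∃ K₀ : ℕ, ∀ K : ℕ, K₀ ≤ K →
      (K : ℝ) * (1 - F (s K)) ≤ C / Real.log K := by
  set a : ℝ := ((J : ℝ) + 1) * (M : ℝ) - 2 with ha
  set A : ℝ := (ρ0 / 2) ^ (M - 1) * ∏ b : Fin J, (ρ b / 2) ^ M with hA
  have hApos : 0 < A := by
    apply mul_pos (by positivity)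
    apply Finset.prod_pos
    intro b _
    have := hρ b
    positivity
  have hlog : Filter.Tendsto (fun K : ℕ => Real.log (K : ℝ)) Filter.atTop Filter.atTop :=
    Real.tendsto_log_atTop.comp tendsto_natCast_atTop_atTop
  have hev : ∀ᶠ L : ℝ in Filter.atTop, a * Real.log L ≤ L / 2 := by
    have h := (Real.isLittleO_log_id_atTop.const_mul_left a).bound (c := 1 / 2) (by norm_num)
    filter_upwards [h, Filter.eventually_ge_atTop 0] with L hL h0
    simp only [id, Real.norm_eq_abs, abs_of_nonneg h0] at hL
    have := le_abs_self (a * Real.log L)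
    linarith
  obtain ⟨K₀, hK₀⟩ := Filter.eventually_atTop.1
    ((hlog.eventually hev).and ((hlog.eventually (Filter.eventually_ge_atTop 1)).and
      (Filter.eventually_ge_atTop 1)))
  refine ⟨1 / A, by positivity, K₀, fun K hK => ?_⟩
  obtain ⟨h1, h2, h3⟩ := hK₀ K hK
  have hKpos : (0 : ℝ) < K := by exact_mod_cast h3
  set L : ℝ := Real.log K with hL
  have hLpos : 0 < L := by linarith
  have hsL : ρ0 * (L / 2) ≤ s K := by
    rw [hs K]
    have := mul_le_mul_of_nonneg_left h1 hρ0.le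
    nlinarith
  have hcard : (∏ b : Fin J, (ρ b / 2 * L) ^ M) = (∏ b : Fin J, (ρ b / 2) ^ M) * L ^ (J * M) := by
    simp only [mul_pow, Finset.prod_mul_distrib, Finset.prod_const, Finset.card_univ,
      Fintype.card_fin]
    rw [← pow_mul, mul_comm M J]
  have hD : A * L ^ (M - 1 + J * M) ≤
      (1 + s K) ^ (M - 1) * ∏ b : Fin J, (1 + (ρ b / ρ0) * s K) ^ M := by
    have e : A * L ^ (M - 1 + J * M) =
        (ρ0 / 2 * L) ^ (M - 1) * ∏ b : Fin J, (ρ b / 2 * L) ^ M := by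
      rw [hcard, hA, pow_add, mul_pow]; ring
    rw [e]
    have hb0 : ∀ b, 0 ≤ ρ b / 2 * L := fun b => by have := hρ b; positivity
    apply mul_le_mul
    · apply pow_le_pow_left₀ (by positivity)
      linarith
    · apply Finset.prod_le_prod
      · intro b _
        exact pow_nonneg (hb0 b) _
      · intro b _
        apply pow_le_pow_left₀ (hb0 b)
        have hb := hρ b
        have h := mul_le_mul_of_nonneg_left hsL (div_pos hb hρ0).le
        have e2 : ρ b / ρ0 * (ρ0 * (L / 2)) = ρ b / 2 * L := by field_simp
        linarith
    · exact Finset.prod_nonneg fun b _ => pow_nonneg (hb0 b) _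
    · apply pow_nonneg
      have : 0 ≤ ρ0 * (L / 2) := by positivity
      linarith
  have hE : (K : ℝ) * Real.exp (-s K / ρ0) * L = L ^ (M - 1 + J * M) := by
    have e1 : -s K / ρ0 = -L + a * Real.log L := by
      rw [hs K]; field_simp; ring
    have e2 : (K : ℝ) = Real.exp L := (Real.exp_log hKpos).symm
    have e3 : L ^ (M - 1 + J * M) = Real.exp (((M - 1 + J * M : ℕ) : ℝ) * Real.log L) := by
      rw [Real.exp_nat_mul, Real.exp_log hLpos]
    have e4 : Real.exp L * Real.exp (-L + a * Real.log L) * L =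
        Real.exp L * Real.exp (-L + a * Real.log L) * Real.exp (Real.log L) := by
      rw [Real.exp_log hLpos]
    rw [e1, e2, e3, e4, ← Real.exp_add, ← Real.exp_add]
    congr 1
    push_cast [Nat.cast_sub hM]
    rw [ha]; ring
  have hNpos : 0 < A * L ^ (M - 1 + J * M) := by positivity
  rw [hF, sub_sub_cancel, ← mul_div_assoc, div_div, div_le_div_iff₀ (hNpos.trans_le hD)
    (by positivity)]
  calc (K : ℝ) * Real.exp (-s K / ρ0) * (A * L)
      = A * ((K : ℝ) * Real.exp (-s K / ρ0) * L) := by ring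
    _ = A * L ^ (M - 1 + J * M) := by rw [hE]
    _ ≤ _ := by rw [one_mul]; exact hD
end

section
/- Let ρ0 > 0, ρ1, …, ρJ > 0, M ≥ 1 an integer, define F(x) = 1 − e^{−x/ρ0} / ((1+x)^{M−1} · ∏_{b=1}^{J} (1 + (ρb/ρ0)·x)^{M}) with derivative f on (0,∞), and for integers K ≥ 2 define the individual sum rate R̂_K = M · ∫₀^∞ ln(1 + x) · K·F(x)^{K−1}·f(x) dx. Then lim_{K→∞} R̂_K / (M · ln ln K) = 1. -/
open Real MeasureTheory Filter

/-- Tame growth: bounds for a denominator and its derivative on the nonnegative reals. -/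
def TameDen (D : ℝ → ℝ) (B : ℝ) : Prop :=
  ∀ x : ℝ, 0 ≤ x → 1 ≤ D x ∧ D x ≤ Real.exp (B * x) ∧
    ∃ d, HasDerivAt D d x ∧ 0 ≤ d ∧ d ≤ B * D x

lemma TameDen.one : TameDen (fun _ => 1) 0 := by
  intro x hx
  exact ⟨le_refl _, by simp, 0, hasDerivAt_const x 1, le_refl _, by simp⟩

lemma TameDen.lin {c : ℝ} (hc : 0 ≤ c) : TameDen (fun x => 1 + c * x) c := by
  intro x hx
  have h := mul_nonneg hc hx
  refine ⟨by simp only; linarith, ?_, c, ?_, hc, ?_⟩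
  · have := Real.add_one_le_exp (c * x)
    simp only; linarith
  · simpa using ((hasDerivAt_id x).const_mul c).const_add 1
  · simp only; nlinarith

lemma TameDen.mul {D E : ℝ → ℝ} {A B : ℝ} (hD : TameDen D A) (hE : TameDen E B) :
    TameDen (fun x => D x * E x) (A + B) := by
  intro x hx
  obtain ⟨h1, h2, d, h3, h4, h5⟩ := hD x hx
  obtain ⟨g1, g2, e, g3, g4, g5⟩ := hE x hx
  refine ⟨one_le_mul_of_one_le_of_one_le h1 g1, ?_, d * E x + D x * e, h3.mul g3, ?_, ?_⟩
  · rw [add_mul, Real.exp_add]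
    exact mul_le_mul h2 g2 (by linarith) (Real.exp_pos _).le
  · have : 0 ≤ d * E x := mul_nonneg h4 (by linarith)
    have : 0 ≤ D x * e := mul_nonneg (by linarith) g4
    linarith
  · have : d * E x ≤ A * D x * E x := mul_le_mul_of_nonneg_right h5 (by linarith)
    have : D x * e ≤ D x * (B * E x) := mul_le_mul_of_nonneg_left g5 (by linarith)
    simp only; linarith

lemma TameDen.pow {D : ℝ → ℝ} {A : ℝ} (hD : TameDen D A) (n : ℕ) :
    ∃ B, TameDen (fun x => D x ^ n) B := by
  induction n with
  | zero => exact ⟨0, by simpa using TameDen.one⟩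
  | succ n ih =>
    obtain ⟨B, hB⟩ := ih
    exact ⟨B + A, by simpa only [pow_succ] using hB.mul hD⟩

lemma TameDen.prod {ι : Type*} (s : Finset ι) {D : ι → ℝ → ℝ} (h : ∀ i, ∃ B, TameDen (D i) B) :
    ∃ B, TameDen (fun x => ∏ i ∈ s, D i x) B := by
  classical
  induction s using Finset.induction_on with
  | empty => exact ⟨0, by simpa using TameDen.one⟩
  | insert a s ha ih =>
    obtain ⟨B, hB⟩ := ih
    obtain ⟨A, hA⟩ := h a
    exact ⟨A + B, by simpa only [Finset.prod_insert ha] using hA.mul hB⟩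

lemma tendsto_loglog : Tendsto (fun K : ℕ => Real.log (Real.log K)) atTop atTop :=
  Real.tendsto_log_atTop.comp (Real.tendsto_log_atTop.comp tendsto_natCast_atTop_atTop)

lemma tendsto_log_ratio {c : ℝ} (hc : 0 < c) :
    Tendsto (fun K : ℕ => Real.log (1 + c * Real.log K) / Real.log (Real.log K)) atTop (nhds 1) := by
  have hL : Tendsto (fun K : ℕ => Real.log K) atTop atTop :=
    Real.tendsto_log_atTop.comp tendsto_natCast_atTop_atTop
  have h1 : Tendsto (fun K : ℕ => Real.log (1 / Real.log K + c)) atTop (nhds (Real.log c)) := by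
    have h2 : Tendsto (fun K : ℕ => 1 / Real.log K + c) atTop (nhds (0 + c)) :=
      (hL.const_div_atTop 1).add tendsto_const_nhds
    rw [zero_add] at h2
    exact h2.log hc.ne'
  have h3 : Tendsto (fun K : ℕ => 1 + Real.log (1 / Real.log K + c) / Real.log (Real.log K))
      atTop (nhds (1 + 0)) := tendsto_const_nhds.add (h1.div_atTop tendsto_loglog)
  rw [add_zero] at h3
  refine h3.congr' ?_
  filter_upwards [hL.eventually_gt_atTop 0, tendsto_loglog.eventually_gt_atTop 0] with K hK hK2
  have : 1 + c * Real.log K = Real.log K * (1 / Real.log K + c) := by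
    field_simp
  rw [this, Real.log_mul hK.ne' (by positivity)]
  field_simp

/-- The abstract form of the scaling law. -/
lemma scaling_core {F : ℝ → ℝ} {C ρ0 : ℝ} (hC : 0 < C) (hρ0 : 0 < ρ0) (hF0 : F 0 = 0)
    (hm : Measurable F)
    (hd : ∀ x, 0 ≤ x → HasDerivAt F (deriv F x) x)
    (hf0 : ∀ x, 0 ≤ x → 0 ≤ deriv F x)
    (hf1 : ∀ x, 0 ≤ x → deriv F x ≤ C * Real.exp (-x / ρ0))
    (hFn : ∀ x, 0 ≤ x → 0 ≤ F x)
    (hFu : ∀ x, 0 ≤ x → F x ≤ 1 - Real.exp (-(C * x)))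
    (hlim : Tendsto F atTop (nhds 1)) :
    Tendsto (fun K : ℕ => (∫ x in Set.Ioi (0 : ℝ),
      Real.log (1 + x) * ((K : ℝ) * (F x) ^ (K - 1) * deriv F x)) / Real.log (Real.log K))
      atTop (nhds 1) := by
  have hF1 : ∀ x, 0 ≤ x → F x ≤ 1 := fun x hx => by
    have := hFu x hx
    have := Real.exp_pos (-(C * x))
    linarith
  have hdK : ∀ K : ℕ, ∀ x, 0 ≤ x →
      HasDerivAt (fun y => F y ^ K) ((K : ℝ) * (F x) ^ (K - 1) * deriv F x) x :=
    fun K x hx => (hd x hx).pow K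
  have hn : ∀ K : ℕ, ∀ x, 0 ≤ x → 0 ≤ (K : ℝ) * (F x) ^ (K - 1) * deriv F x := fun K x hx =>
    mul_nonneg (mul_nonneg (Nat.cast_nonneg _) (pow_nonneg (hFn x hx) _)) (hf0 x hx)
  have hlimK : ∀ K : ℕ, Tendsto (fun y => F y ^ K) atTop (nhds 1) := fun K => by
    simpa using hlim.pow K
  have hint : ∀ K : ℕ, ∀ a, 0 ≤ a →
      IntegrableOn (fun x => (K : ℝ) * (F x) ^ (K - 1) * deriv F x) (Set.Ioi a) := fun K a ha =>
    integrableOn_Ioi_deriv_of_nonneg (hdK K a ha).continuousAt.continuousWithinAt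
      (fun x hx => hdK K x (ha.trans (le_of_lt hx)))
      (fun x hx => hn K x (ha.trans (le_of_lt hx))) (hlimK K)
  have hval : ∀ K : ℕ, ∀ a, 0 ≤ a →
      ∫ x in Set.Ioi a, (K : ℝ) * (F x) ^ (K - 1) * deriv F x = 1 - F a ^ K := fun K a ha =>
    integral_Ioi_of_hasDerivAt_of_nonneg (hdK K a ha).continuousAt.continuousWithinAt
      (fun x hx => hdK K x (ha.trans (le_of_lt hx)))
      (fun x hx => hn K x (ha.trans (le_of_lt hx))) (hlimK K)
  set G : ℝ → ℝ := fun x => C * (x * Real.exp (-(1 / (2 * ρ0)) * x)) with hG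
  have hGint : IntegrableOn G (Set.Ioi 0) := by
    have h := integrableOn_rpow_mul_exp_neg_mul_rpow (s := 1) (p := 1) (b := 1 / (2 * ρ0))
      (by norm_num) one_pos (by positivity)
    simp only [Real.rpow_one] at h
    exact h.const_mul C
  have hG0 : ∀ x, 0 ≤ x → 0 ≤ G x := fun x hx => by
    simp only [hG]; positivity
  have hdom : ∀ K : ℕ, 2 ≤ K → ∀ x, 0 ≤ x →
      Real.log (1 + x) * ((K : ℝ) * (F x) ^ (K - 1) * deriv F x) ≤
      Real.log (1 + 2 * ρ0 * Real.log K) * ((K : ℝ) * (F x) ^ (K - 1) * deriv F x) + G x := by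
    intro K hK x hx
    have hK1 : (1 : ℝ) ≤ K := by exact_mod_cast (by omega : 1 ≤ K)
    have hlogK := Real.log_nonneg hK1
    have h2 : 0 ≤ 2 * ρ0 * Real.log K := by positivity
    rcases le_total x (2 * ρ0 * Real.log K) with h | h
    · have h3 : Real.log (1 + x) ≤ Real.log (1 + 2 * ρ0 * Real.log K) :=
        Real.log_le_log (by linarith) (by linarith)
      have := mul_le_mul_of_nonneg_right h3 (hn K x hx)
      have := hG0 x hx
      linarith
    · have h3 : 0 ≤ Real.log (1 + 2 * ρ0 * Real.log K) := Real.log_nonneg (by linarith)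
      have h4 := mul_nonneg h3 (hn K x hx)
      have h5 : Real.log (1 + x) ≤ x := by
        have := Real.log_le_sub_one_of_pos (show 0 < 1 + x by linarith)
        linarith
      have h6 : (F x) ^ (K - 1) ≤ 1 := pow_le_one₀ (hFn x hx) (hF1 x hx)
      have hKe : (K : ℝ) ≤ Real.exp (x / (2 * ρ0)) := by
        rw [← Real.log_le_iff_le_exp (by linarith), le_div_iff₀ (by positivity)]
        linarith
      have h7 : (K : ℝ) * (F x) ^ (K - 1) * deriv F x ≤
          Real.exp (x / (2 * ρ0)) * 1 * (C * Real.exp (-x / ρ0)) := by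
        have := hf0 x hx
        have := hf1 x hx
        have := hFn x hx
        gcongr
      have h8 : Real.exp (x / (2 * ρ0)) * 1 * (C * Real.exp (-x / ρ0)) =
          C * Real.exp (-(1 / (2 * ρ0)) * x) := by
        have : Real.exp (-(1 / (2 * ρ0)) * x) = Real.exp (x / (2 * ρ0)) * Real.exp (-x / ρ0) := by
          rw [← Real.exp_add]
          congr 1
          field_simp
          ring
        rw [this]; ring
      have h9 := mul_le_mul h5 (h7.trans_eq h8) (hn K x hx) hx
      simp only [hG]
      linarith
  have hdomint : ∀ K : ℕ, IntegrableOn (fun x => Real.log (1 + 2 * ρ0 * Real.log K) *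
      ((K : ℝ) * (F x) ^ (K - 1) * deriv F x) + G x) (Set.Ioi 0) := fun K =>
    ((hint K 0 le_rfl).const_mul _).add hGint
  have hIn : ∀ K : ℕ, ∀ x, 0 ≤ x →
      0 ≤ Real.log (1 + x) * ((K : ℝ) * (F x) ^ (K - 1) * deriv F x) := fun K x hx =>
    mul_nonneg (Real.log_nonneg (by linarith)) (hn K x hx)
  have hIint : ∀ K : ℕ, 2 ≤ K → IntegrableOn (fun x =>
      Real.log (1 + x) * ((K : ℝ) * (F x) ^ (K - 1) * deriv F x)) (Set.Ioi 0) := by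
    intro K hK
    refine (hdomint K).mono' ?_ ?_
    · have hdm : Measurable (deriv F) := measurable_deriv F
      have : Measurable (fun x =>
        Real.log (1 + x) * ((K : ℝ) * (F x) ^ (K - 1) * deriv F x)) := by fun_prop
      exact this.aestronglyMeasurable
    · filter_upwards [ae_restrict_mem measurableSet_Ioi] with x hx
      rw [Real.norm_of_nonneg (hIn K x (le_of_lt hx))]
      exact hdom K hK x (le_of_lt hx)
  have hup : ∀ K : ℕ, 2 ≤ K → ∫ x in Set.Ioi (0 : ℝ),
      Real.log (1 + x) * ((K : ℝ) * (F x) ^ (K - 1) * deriv F x) ≤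
      Real.log (1 + 2 * ρ0 * Real.log K) + ∫ x in Set.Ioi (0 : ℝ), G x := by
    intro K hK
    have h := setIntegral_mono_on (hIint K hK) (hdomint K) measurableSet_Ioi
      (fun x hx => hdom K hK x (le_of_lt hx))
    rw [integral_add ((hint K 0 le_rfl).const_mul _) hGint, integral_const_mul,
      hval K 0 le_rfl, hF0, zero_pow (by omega)] at h
    simpa using h
  have hlow : ∀ K : ℕ, 2 ≤ K → Real.log (1 + 1 / (2 * C) * Real.log K) *
      (1 - Real.exp (-Real.sqrt K)) ≤ ∫ x in Set.Ioi (0 : ℝ),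
      Real.log (1 + x) * ((K : ℝ) * (F x) ^ (K - 1) * deriv F x) := by
    intro K hK
    have hK1 : (1 : ℝ) ≤ K := by exact_mod_cast (by omega : 1 ≤ K)
    have hlogK := Real.log_nonneg hK1
    set a := 1 / (2 * C) * Real.log K with ha
    have ha0 : 0 ≤ a := by positivity
    have hla : 0 ≤ Real.log (1 + a) := Real.log_nonneg (by linarith)
    have hsub : Set.Ioi a ⊆ Set.Ioi (0 : ℝ) := Set.Ioi_subset_Ioi ha0
    have h1 : ∫ x in Set.Ioi a, Real.log (1 + x) * ((K : ℝ) * (F x) ^ (K - 1) * deriv F x) ≤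
        ∫ x in Set.Ioi (0 : ℝ), Real.log (1 + x) * ((K : ℝ) * (F x) ^ (K - 1) * deriv F x) := by
      refine setIntegral_mono_set (hIint K hK) ?_ hsub.eventuallyLE
      filter_upwards [ae_restrict_mem measurableSet_Ioi] with x hx
      exact hIn K x (le_of_lt hx)
    have h2 := setIntegral_mono_on ((hint K a ha0).const_mul (Real.log (1 + a)))
      ((hIint K hK).mono_set hsub) measurableSet_Ioi (fun x hx => by
        have hx' : a < x := hx
        exact mul_le_mul_of_nonneg_right
          (Real.log_le_log (by linarith) (by linarith)) (hn K x (by linarith)))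
    rw [integral_const_mul, hval K a ha0] at h2
    refine le_trans ?_ (h2.trans h1)
    refine mul_le_mul_of_nonneg_left ?_ hla
    have h3 : F a ^ K ≤ Real.exp (-Real.sqrt K) := by
      have h4 : F a ≤ Real.exp (-Real.exp (-(C * a))) := by
        have := hFu a ha0
        have := Real.add_one_le_exp (-Real.exp (-(C * a)))
        linarith
      have h5 := pow_le_pow_left₀ (hFn a ha0) h4 K
      rw [← Real.exp_nat_mul] at h5
      have h6 : Real.exp (-(C * a)) = (Real.sqrt K)⁻¹ := by
        have : C * a = Real.log (Real.sqrt K) := by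
          rw [Real.log_sqrt (by linarith), ha]; field_simp
        rw [this, Real.exp_neg, Real.exp_log (Real.sqrt_pos.2 (by linarith))]
      rw [h6] at h5
      have h7 : (K : ℝ) * -(Real.sqrt K)⁻¹ = -Real.sqrt K := by
        rw [mul_neg, ← div_eq_mul_inv, Real.div_sqrt]
      rwa [h7] at h5
    linarith
  have hsq : Tendsto (fun K : ℕ => 1 - Real.exp (-Real.sqrt K)) atTop (nhds (1 - 0)) :=
    tendsto_const_nhds.sub (Real.tendsto_exp_neg_atTop_nhds_zero.comp
      (Real.tendsto_sqrt_atTop.comp tendsto_natCast_atTop_atTop))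
  have hlo := (tendsto_log_ratio (show 0 < 1 / (2 * C) by positivity)).mul hsq
  have hhi := (tendsto_log_ratio (show 0 < 2 * ρ0 by positivity)).add
    (tendsto_loglog.const_div_atTop (∫ x in Set.Ioi (0 : ℝ), G x))
  rw [sub_zero, mul_one] at hlo
  rw [add_zero] at hhi
  refine tendsto_of_tendsto_of_tendsto_of_le_of_le' hlo hhi ?_ ?_
  · filter_upwards [eventually_ge_atTop 2, tendsto_loglog.eventually_gt_atTop 0] with K hK hl
    rw [div_mul_eq_mul_div]
    exact div_le_div_of_nonneg_right (hlow K hK) hl.le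
  · filter_upwards [eventually_ge_atTop 2, tendsto_loglog.eventually_gt_atTop 0] with K hK hl
    rw [← add_div]
    exact div_le_div_of_nonneg_right (hup K hK) hl.le

/-- Individual scaling law: the individual sum rate
`R̂_K = M · ∫₀^∞ ln(1 + x)·K·F(x)^{K−1}·f(x) dx` under CDF-based scheduling with `K` users
satisfies `lim_{K→∞} R̂_K / (M · ln ln K) = 1`. -/
theorem individual_scaling_law
    {M J : ℕ} (hM : 1 ≤ M) {ρ0 : ℝ} (hρ0 : 0 < ρ0) {ρ : Fin J → ℝ} (hρ : ∀ b, 0 < ρ b)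
    (F : ℝ → ℝ)
    (hF : ∀ x : ℝ, F x = 1 - Real.exp (-x / ρ0) /
      ((1 + x) ^ (M - 1) * ∏ b : Fin J, (1 + (ρ b / ρ0) * x) ^ M))
    (R : ℕ → ℝ)
    (hR : ∀ K : ℕ, 2 ≤ K → R K = (M : ℝ) *
      ∫ x in Set.Ioi (0 : ℝ), Real.log (1 + x) * ((K : ℝ) * (F x) ^ (K - 1) * deriv F x)) :
    Tendsto (fun K : ℕ => R K / ((M : ℝ) * Real.log (Real.log K))) atTop (nhds 1) := by
  obtain ⟨B, hB⟩ : ∃ B, TameDen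
      (fun x => (1 + x) ^ (M - 1) * ∏ b : Fin J, (1 + (ρ b / ρ0) * x) ^ M) B := by
    obtain ⟨B1, h1⟩ := (TameDen.lin (c := 1) zero_le_one).pow (M - 1)
    obtain ⟨B2, h2⟩ := TameDen.prod Finset.univ
      (D := fun (b : Fin J) x => (1 + (ρ b / ρ0) * x) ^ M)
      (fun b => (TameDen.lin (div_pos (hρ b) hρ0).le).pow M)
    simp only [one_mul] at h1
    exact ⟨B1 + B2, h1.mul h2⟩
  have hF0 : F 0 = 0 := by simp [hF]
  have hm : Measurable F := by
    rw [funext hF]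
    fun_prop
  set D : ℝ → ℝ := fun x => (1 + x) ^ (M - 1) * ∏ b : Fin J, (1 + (ρ b / ρ0) * x) ^ M with hD
  have hFD : F = fun x => 1 - Real.exp (-x / ρ0) / D x := funext hF
  have hB0 : 0 ≤ B := by
    obtain ⟨h1, -, d, -, h3, h4⟩ := hB 0 le_rfl
    by_contra h
    push Not at h
    nlinarith
  have hder : ∀ x, 0 ≤ x → ∃ f, HasDerivAt F f x ∧ 0 ≤ f ∧
      f ≤ (1 / ρ0 + B) * Real.exp (-x / ρ0) := by
    intro x hx
    obtain ⟨h1, -, d, h2, h3, h4⟩ := hB x hx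
    have hDp : 0 < D x := by linarith
    have he : HasDerivAt (fun x => Real.exp (-x / ρ0)) (Real.exp (-x / ρ0) * (-1 / ρ0)) x :=
      (((hasDerivAt_id x).neg).div_const ρ0).exp
    have hq := (he.div h2 hDp.ne').const_sub 1
    refine ⟨Real.exp (-x / ρ0) * ((1 / ρ0 * D x + d) / D x ^ 2), ?_, by positivity, ?_⟩
    · rw [hFD]
      refine hq.congr_deriv ?_
      ring
    · rw [mul_comm]
      refine mul_le_mul_of_nonneg_right ?_ (Real.exp_pos _).le
      rw [div_le_iff₀ (by positivity)]
      have h5 : 0 ≤ 1 / ρ0 + B := by positivity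
      have h6 : 1 / ρ0 * D x + d ≤ (1 / ρ0 + B) * D x := by linarith
      have h7 : D x ≤ D x ^ 2 := by nlinarith
      exact h6.trans (mul_le_mul_of_nonneg_left h7 h5)
  have hle : ∀ x, 0 ≤ x → Real.exp (-x / ρ0) / D x ≤ Real.exp (-x / ρ0) := fun x hx =>
    div_le_self (Real.exp_pos _).le (hB x hx).1
  have hexp0 : Tendsto (fun x : ℝ => Real.exp (-x / ρ0)) atTop (nhds 0) := by
    have := Real.tendsto_exp_neg_atTop_nhds_zero.comp (tendsto_id.atTop_div_const hρ0)
    refine this.congr fun x => ?_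
    simp [neg_div]
  have key := scaling_core (F := F) (C := 1 / ρ0 + B) (ρ0 := ρ0) (by positivity) hρ0 hF0 hm
    (fun x hx => by
      obtain ⟨f, h1, -⟩ := hder x hx
      exact h1.differentiableAt.hasDerivAt)
    (fun x hx => by
      obtain ⟨f, h1, h2, -⟩ := hder x hx
      rwa [h1.deriv])
    (fun x hx => by
      obtain ⟨f, h1, -, h3⟩ := hder x hx
      rwa [h1.deriv])
    (fun x hx => by
      rw [hFD]
      have h1 := hle x hx
      have h2 : Real.exp (-x / ρ0) ≤ 1 := by
        rw [Real.exp_le_one_iff, neg_div]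
        have : 0 ≤ x / ρ0 := by positivity
        linarith
      simp only
      linarith)
    (fun x hx => by
      obtain ⟨h1, h2, -⟩ := hB x hx
      have h3 : Real.exp (-((1 / ρ0 + B) * x)) ≤ Real.exp (-x / ρ0) / D x := by
        rw [le_div_iff₀ (by linarith)]
        calc Real.exp (-((1 / ρ0 + B) * x)) * D x
            ≤ Real.exp (-((1 / ρ0 + B) * x)) * Real.exp (B * x) :=
              mul_le_mul_of_nonneg_left h2 (Real.exp_pos _).le
          _ = Real.exp (-x / ρ0) := by
              rw [← Real.exp_add]
              congr 1
              ring
      rw [hFD]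
      simp only
      linarith)
    (by
      have h1 : Tendsto (fun x => Real.exp (-x / ρ0) / D x) atTop (nhds 0) := by
        refine tendsto_of_tendsto_of_tendsto_of_le_of_le' tendsto_const_nhds hexp0 ?_ ?_
        · filter_upwards [eventually_ge_atTop 0] with x hx
          have := (hB x hx).1
          exact div_nonneg (Real.exp_pos _).le (by linarith)
        · filter_upwards [eventually_ge_atTop 0] with x hx
          exact hle x hx
      rw [hFD]
      simpa using h1.const_sub 1)
  refine key.congr' ?_
  filter_upwards [eventually_ge_atTop 2] with K hK
  rw [hR K hK, mul_div_mul_left]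
  have : 0 < M := hM
  positivity
end
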